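/- For every rational number λ > 1, the group G_λ is fully left-orderable: every subsemigroup of G_λ not containing the identity is contained in a positive cone of a left-order on G_λ. -/

import Mathlib

/-- A positive cone of a left-order on `G`: a subsemigroup `P` such that for every `g`
exactly one of `g ∈ P`, `g = 1`, `g⁻¹ ∈ P` holds. -/
def IsLeftOrderCone {G : Type*} [Group G] (P : Subsemigroup G) : Prop :=
  (∀ g : G, g ∈ P ∨ g = 1 ∨ g⁻¹ ∈ P) ∧ (1 : G) ∉ P ∧ ∀ g : G, g ∈ P → g⁻¹ ∉ P

/-- `G` is fully left-orderable: every subsemigroup not containing the identity is contained in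
a positive cone of a left-order. -/
def FullyLeftOrderable (G : Type*) [Group G] : Prop :=
  ∀ Q : Subsemigroup G, (1 : G) ∉ Q → ∃ P : Subsemigroup G, IsLeftOrderCone P ∧ Q ≤ P

/-- The subring `ℤ[λ, λ⁻¹]` of `ℚ`. -/
def laurentRing (lam : ℚ) : Subring ℚ := Subring.closure {lam, lam⁻¹}

theorem zpow_mem_laurentRing (lam : ℚ) (n : ℤ) : lam ^ n ∈ laurentRing lam := by
  cases n with
  | ofNat k =>
      change lam ^ (k : ℤ) ∈ laurentRing lam
      rw [zpow_natCast]
      exact pow_mem (Subring.subset_closure (by simp)) k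
  | negSucc k =>
      rw [zpow_negSucc, ← inv_pow]
      exact pow_mem (Subring.subset_closure (by simp)) (k + 1)

/-- The group `G_λ` of bijections of `ℚ` of the form `x ↦ λ^n x + c` with `n ∈ ℤ` and
`c ∈ ℤ[λ, λ⁻¹]`, as a subgroup of the permutation group of `ℚ`. -/
def GLam (lam : ℚ) (hlam : 1 < lam) : Subgroup (Equiv.Perm ℚ) where
  carrier := {f : Equiv.Perm ℚ | ∃ n : ℤ, ∃ c ∈ laurentRing lam,
    ∀ x : ℚ, f x = lam ^ n * x + c}
  one_mem' := ⟨0, 0, Subring.zero_mem _, fun x => by simp⟩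
  mul_mem' := by
    rintro f g ⟨n, c, hc, hf⟩ ⟨m, d, hd, hg⟩
    have hlam0 : lam ≠ 0 := ne_of_gt (lt_trans one_pos hlam)
    refine ⟨n + m, lam ^ n * d + c,
      Subring.add_mem _ (Subring.mul_mem _ (zpow_mem_laurentRing lam n) hd) hc, fun x => ?_⟩
    have h1 : (f * g) x = f (g x) := rfl
    rw [h1, hg, hf, zpow_add₀ hlam0]
    ring
  inv_mem' := by
    rintro f ⟨n, c, hc, hf⟩
    have hlam0 : lam ≠ 0 := ne_of_gt (lt_trans one_pos hlam)
    have hmul : lam ^ n * lam ^ (-n) = 1 := by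
      rw [← zpow_add₀ hlam0]; simp
    refine ⟨-n, -(lam ^ (-n) * c),
      Subring.neg_mem _ (Subring.mul_mem _ (zpow_mem_laurentRing lam (-n)) hc), fun x => ?_⟩
    have key : f (lam ^ (-n) * x + -(lam ^ (-n) * c)) = x := by
      calc f (lam ^ (-n) * x + -(lam ^ (-n) * c))
          = lam ^ n * (lam ^ (-n) * x + -(lam ^ (-n) * c)) + c := hf _
        _ = (lam ^ n * lam ^ (-n)) * x - (lam ^ n * lam ^ (-n)) * c + c := by ring
        _ = x := by rw [hmul]; ring
    calc f⁻¹ x = f⁻¹ (f (lam ^ (-n) * x + -(lam ^ (-n) * c))) := by rw [key]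
      _ = lam ^ (-n) * x + -(lam ^ (-n) * c) := Equiv.symm_apply_apply f _

theorem aux_pow_mem {G : Type*} [Group G] (Q : Subsemigroup G) {g : G} (hg : g ∈ Q) :
    ∀ k : ℕ, 0 < k → g ^ k ∈ Q := by
  intro k hk
  obtain ⟨m, rfl⟩ : ∃ m, k = m + 1 := ⟨k - 1, by omega⟩
  clear hk
  induction m with
  | zero => simpa using hg
  | succ m ih => rw [pow_succ]; exact Q.mul_mem ih hg

theorem aux_flip {G : Type*} [Group G] (Q : Subsemigroup G) :
    ∃ Q' : Subsemigroup G, ∀ g, g ∈ Q' ↔ g⁻¹ ∈ Q :=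
  ⟨{ carrier := {g | g⁻¹ ∈ Q}
     mul_mem' := by
      intro a b ha hb
      simp only [Set.mem_ofPred_eq, mul_inv_rev] at *
      exact Q.mul_mem hb ha }, fun g => Iff.rfl⟩

theorem aux_flip_cone {G : Type*} [Group G] (Q : Subsemigroup G)
    (h : ∃ P : Subsemigroup G, IsLeftOrderCone P ∧ ∀ g ∈ Q, g⁻¹ ∈ P) :
    ∃ P : Subsemigroup G, IsLeftOrderCone P ∧ Q ≤ P := by
  obtain ⟨P, ⟨h1, h2, h3⟩, hQ⟩ := h
  obtain ⟨P', hP'⟩ := aux_flip P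
  refine ⟨P', ⟨fun g => ?_, ?_, fun g hg => ?_⟩, fun g hg => (hP' g).2 (hQ g hg)⟩
  · rw [hP', hP', inv_inv]
    rcases h1 g with h | h | h <;> simp [h]
  · rw [hP']; simpa using h2
  · rw [hP', inv_inv]
    intro h
    exact h3 _ h ((hP' g).1 hg)

section
variable {G : Type*} [Group G] {lam : ℚ} (hlam : 1 < lam) (n : G → ℤ) (c : G → ℚ)
  (hn : ∀ g h, n (g * h) = n g + n h) (hc : ∀ g h, c (g * h) = lam ^ n g * c h + c g)
  (hinj : ∀ g, n g = 0 → c g = 0 → g = 1)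

theorem aux_n1 (hn : ∀ g h, n (g * h) = n g + n h) : n 1 = 0 := by
  have := hn 1 1
  simp at this; exact this

theorem aux_c1 (hn : ∀ g h, n (g * h) = n g + n h)
    (hc : ∀ g h, c (g * h) = lam ^ n g * c h + c g) : c 1 = 0 := by
  have := hc 1 1
  simp [aux_n1 n hn] at this; exact this

theorem aux_ninv (hn : ∀ g h, n (g * h) = n g + n h) (g : G) : n g⁻¹ = - n g := by
  have := hn g g⁻¹
  simp [aux_n1 n hn] at this; omega

theorem aux_cinv (hlam : 1 < lam) (hn : ∀ g h, n (g * h) = n g + n h)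
    (hc : ∀ g h, c (g * h) = lam ^ n g * c h + c g) (g : G) : 
    c g = - (lam ^ n g * c g⁻¹) := by
  have := hc g g⁻¹
  simp only [mul_inv_cancel, aux_c1 n c hn hc] at this
  linarith

theorem aux_npow (hn : ∀ g h, n (g * h) = n g + n h) (g : G) (k : ℕ) :
    n (g ^ k) = k * n g := by
  induction k with
  | zero => simp [aux_n1 n hn]
  | succ k ih => rw [pow_succ, hn, ih]; push_cast; ring

theorem aux_cpow (hlam : 1 < lam) (hn : ∀ g h, n (g * h) = n g + n h)
    (hc : ∀ g h, c (g * h) = lam ^ n g * c h + c g) (g : G) (x : ℚ)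
    (hx : c g = (1 - lam ^ n g) * x) (k : ℕ) :
    c (g ^ k) = (1 - lam ^ (k * n g)) * x := by
  induction k with
  | zero => simp [aux_c1 n c hn hc]
  | succ k ih =>
    rw [pow_succ, hc, ih, aux_npow n hn, hx]
    push_cast
    rw [add_mul, zpow_add₀ (by positivity), one_mul]; ring

theorem aux_cpow0 (hn : ∀ g h, n (g * h) = n g + n h)
    (hc : ∀ g h, c (g * h) = lam ^ n g * c h + c g) (g : G) (hg : n g = 0) (k : ℕ) :
    c (g ^ k) = k * c g := by
  induction k with
  | zero => simp [aux_c1 n c hn hc]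
  | succ k ih =>
    rw [pow_succ, hc, ih, aux_npow n hn, hg]
    push_cast
    simp; ring

theorem aux_key1 (hn : ∀ g h, n (g * h) = n g + n h)
    (hc : ∀ g h, c (g * h) = lam ^ n g * c h + c g)
    (hinj : ∀ g, n g = 0 → c g = 0 → g = 1) (Q : Subsemigroup G) (hQ : (1 : G) ∉ Q)
    (g h : G) (hg : g ∈ Q) (hh : h ∈ Q) (ng : n g = 0) (nh : n h = 0)
    (cg : 0 < c g) (ch : c h < 0) : False := by
  apply hQ
  have e1 : 0 < (c g).num := Rat.num_pos.2 cg
  have e2 : (c h).num < 0 := Rat.num_neg.2 ch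
  obtain ⟨a, ha⟩ := Int.eq_ofNat_of_zero_le e1.le
  obtain ⟨b, hb⟩ := Int.eq_ofNat_of_zero_le (a := -(c h).num) (by omega)
  have da := (c g).den_pos
  have db := (c h).den_pos
  have m1 := aux_pow_mem Q hg (b * (c g).den) (Nat.mul_pos (by omega) da)
  have m2 := aux_pow_mem Q hh (a * (c h).den) (Nat.mul_pos (by omega) db)
  have m := Q.mul_mem m1 m2
  refine (hinj _ ?_ ?_) ▸ m
  · rw [hn, aux_npow n hn, aux_npow n hn, ng, nh]; simp
  · rw [hc, aux_npow n hn, aux_cpow0 n c hn hc g ng, aux_cpow0 n c hn hc h nh, ng]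
    have f1 : ((c g).den : ℚ) * c g = a := by
      rw [mul_comm, Rat.mul_den_eq_num, ha]; simp
    have f2 : ((c h).den : ℚ) * c h = -b := by
      rw [mul_comm, Rat.mul_den_eq_num, show (c h).num = -(b : ℤ) by omega]; simp
    push_cast
    rw [mul_zero, zpow_zero, mul_assoc (b : ℚ), mul_assoc (a : ℚ), f1, f2]; ring

theorem aux_key2 (hlam : 1 < lam) (hn : ∀ g h, n (g * h) = n g + n h)
    (hc : ∀ g h, c (g * h) = lam ^ n g * c h + c g)
    (Q : Subsemigroup G) (hpos : ∀ g ∈ Q, n g = 0 → 0 < c g)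
    (g f : G) (hg : g ∈ Q) (hf : f ∈ Q) (ng : 0 < n g) (nf : n f < 0) (x y : ℚ)
    (hx : c g = (1 - lam ^ n g) * x) (hy : c f = (1 - lam ^ n f) * y) : x < y := by
  obtain ⟨a, ha⟩ := Int.eq_ofNat_of_zero_le ng.le
  obtain ⟨b, hb⟩ := Int.eq_ofNat_of_zero_le (a := - n f) (by omega)
  have m := Q.mul_mem (aux_pow_mem Q hg b (by omega)) (aux_pow_mem Q hf a (by omega))
  have hb' : n f = - b := by omega
  have h0 := hpos _ m (by
    rw [hn, aux_npow n hn, aux_npow n hn, ha, hb']; simp; ring)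
  rw [hc, aux_cpow n c hlam hn hc g x hx, aux_cpow n c hlam hn hc f y hy, aux_npow n hn,
    ha, hb'] at h0
  have hp : (1 : ℚ) < lam ^ ((b : ℤ) * a) := one_lt_zpow₀ hlam (by
    apply mul_pos <;> omega)
  have e : (lam : ℚ) ^ ((a : ℤ) * -b) = (lam ^ ((b : ℤ) * a))⁻¹ := by
    rw [← zpow_neg]; congr 1; ring
  rw [e] at h0
  generalize lam ^ ((b : ℤ) * a) = L at *
  have : L * ((1 - L⁻¹) * y) = (L - 1) * y := by
    have : L ≠ 0 := by linarith
    field_simp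
  rw [this] at h0
  nlinarith

theorem aux_lex (hlam : 1 < lam) (hn : ∀ g h, n (g * h) = n g + n h)
    (hc : ∀ g h, c (g * h) = lam ^ n g * c h + c g)
    (hinj : ∀ g, n g = 0 → c g = 0 → g = 1) (e : ℤ) (he : e ≠ 0) :
    ∃ P : Subsemigroup G, IsLeftOrderCone P ∧
      ∀ g, g ∈ P ↔ (0 < e * n g ∨ n g = 0 ∧ 0 < c g) := by
  obtain ⟨P, hm⟩ : ∃ P : Subsemigroup G, ∀ g, g ∈ P ↔ (0 < e * n g ∨ n g = 0 ∧ 0 < c g) := by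
   refine ⟨{ carrier := {g | 0 < e * n g ∨ n g = 0 ∧ 0 < c g}, mul_mem' := ?_ }, fun g => Iff.rfl⟩
   · intro a b ha hb
     simp only [Set.mem_ofPred_eq] at *
     rw [hn, hc]
     rcases ha with ha | ⟨ha, ha'⟩ <;> rcases hb with hb | ⟨hb, hb'⟩
     · left; linarith
     · left; rw [hb]; simpa using ha
     · left; rw [ha]; simpa using hb
     · right; rw [ha, hb]; simp; linarith
  refine ⟨P, ?_, hm⟩
  · refine ⟨fun g => ?_, ?_, fun g => ?_⟩
    · rw [hm, hm, aux_ninv n hn]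
      rcases lt_trichotomy (e * n g) 0 with h | h | h
      · right; right; left; linarith
      · have h0 : n g = 0 := by simpa [he] using h
        have := aux_cinv n c hlam hn hc g
        rw [h0] at this
        simp at this
        rcases lt_trichotomy (c g) 0 with h | h | h
        · right; right; right; exact ⟨by omega, by linarith⟩
        · right; left; exact hinj g h0 h
        · left; right; exact ⟨h0, h⟩
      · left; left; exact h
    · rw [hm, aux_n1 n hn, aux_c1 n c hn hc]; simp
    · rw [hm, hm, aux_ninv n hn]
      rintro (h | ⟨h, h'⟩) (k | ⟨k, k'⟩)
      · linarith
      · have : n g = 0 := by omega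
        simp [this] at h
      · simp [h] at k
      · have := aux_cinv n c hlam hn hc g
        rw [h] at this
        simp at this
        linarith

theorem aux_aff (hlam : 1 < lam) (hn : ∀ g h, n (g * h) = n g + n h)
    (hc : ∀ g h, c (g * h) = lam ^ n g * c h + c g)
    (hinj : ∀ g, n g = 0 → c g = 0 → g = 1) (e : ℤ) (he : e ≠ 0) (x : ℝ) :
    ∃ P : Subsemigroup G, IsLeftOrderCone P ∧
      ∀ g, g ∈ P ↔ (x < (lam : ℝ) ^ n g * x + c g ∨ 
        x = (lam : ℝ) ^ n g * x + c g ∧ 0 < e * n g) := by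
  have hl : (0 : ℝ) < lam := by exact_mod_cast (by linarith : (0 : ℚ) < lam)
  obtain ⟨P, hm⟩ : ∃ P : Subsemigroup G, ∀ g, g ∈ P ↔ (x < (lam : ℝ) ^ n g * x + c g ∨ 
        x = (lam : ℝ) ^ n g * x + c g ∧ 0 < e * n g) := by
   refine ⟨{ carrier := {g | x < (lam : ℝ) ^ n g * x + c g ∨ 
        x = (lam : ℝ) ^ n g * x + c g ∧ 0 < e * n g}, mul_mem' := ?_ }, fun g => Iff.rfl⟩
   · intro a b ha hb
     simp only [Set.mem_ofPred_eq] at *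
     have hE : (lam : ℝ) ^ n (a * b) * x + c (a * b) = 
         (lam : ℝ) ^ n a * ((lam : ℝ) ^ n b * x + c b) + c a := by
       rw [hn, hc, zpow_add₀ hl.ne']; push_cast; ring
     rw [hE, hn]
     have hp : (0 : ℝ) < (lam : ℝ) ^ n a := zpow_pos hl _
     rcases hb with hb | ⟨hb, hb'⟩
     · left
       have := mul_lt_mul_of_pos_left hb hp
       rcases ha with ha | ⟨ha, ha'⟩ <;> linarith
     · rw [← hb]
       rcases ha with ha | ⟨ha, ha'⟩
       · left; exact ha
       · right; exact ⟨ha, by linarith⟩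
  refine ⟨P, ?_, hm⟩
  · have hE : ∀ g, x = (lam : ℝ) ^ n g * ((lam : ℝ) ^ n g⁻¹ * x + c g⁻¹) + c g := by
      intro g
      have h1 : (c g : ℝ) = - ((lam : ℝ) ^ n g * c g⁻¹) := by
        have := aux_cinv n c hlam hn hc g
        exact_mod_cast this
      have h2 : (lam : ℝ) ^ n g * (lam : ℝ) ^ n g⁻¹ = 1 := by
        rw [aux_ninv n hn, ← zpow_add₀ hl.ne']; simp
      rw [mul_add, ← mul_assoc, h2, h1]; ring
    have hI1 : ∀ g, x < (lam : ℝ) ^ n g * x + c g → (lam : ℝ) ^ n g⁻¹ * x + c g⁻¹ < x := by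
      intro g h
      have hp : (0 : ℝ) < (lam : ℝ) ^ n g := zpow_pos hl _
      have := hE g
      refine lt_of_mul_lt_mul_left ?_ hp.le
      linarith
    have hI2 : ∀ g, (lam : ℝ) ^ n g * x + c g < x → x < (lam : ℝ) ^ n g⁻¹ * x + c g⁻¹ := by
      intro g h
      have hp : (0 : ℝ) < (lam : ℝ) ^ n g := zpow_pos hl _
      have := hE g
      refine lt_of_mul_lt_mul_left ?_ hp.le
      linarith
    have hI3 : ∀ g, x = (lam : ℝ) ^ n g * x + c g → x = (lam : ℝ) ^ n g⁻¹ * x + c g⁻¹ := by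
      intro g h
      have hp : (0 : ℝ) < (lam : ℝ) ^ n g := zpow_pos hl _
      have := hE g
      refine mul_left_cancel₀ hp.ne' ?_
      linarith
    refine ⟨fun g => ?_, ?_, fun g => ?_⟩
    · rw [hm, hm]
      rcases lt_trichotomy x ((lam : ℝ) ^ n g * x + c g) with h | h | h
      · left; left; exact h
      · have h' := hI3 g h
        rcases lt_trichotomy (e * n g) 0 with k | k | k
        · right; right; right; refine ⟨h', ?_⟩
          rw [aux_ninv n hn]; linarith
        · have h0 : n g = 0 := by simpa [he] using k
          right; left; refine hinj g h0 ?_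
          rw [h0] at h
          simp at h; exact h
        · left; right; exact ⟨h, k⟩
      · right; right; left; exact hI2 g h
    · rw [hm, aux_n1 n hn, aux_c1 n c hn hc]; simp
    · rw [hm, hm]
      rintro (h | ⟨h, h'⟩) (k | ⟨k, k'⟩)
      · linarith [hI1 g h]
      · linarith [hI1 g h]
      · linarith [hI3 g h]
      · rw [aux_ninv n hn] at k'; linarith

theorem aux_main_pos (hlam : 1 < lam) (hn : ∀ g h, n (g * h) = n g + n h)
    (hc : ∀ g h, c (g * h) = lam ^ n g * c h + c g)
    (hinj : ∀ g, n g = 0 → c g = 0 → g = 1) (Q : Subsemigroup G)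
    (hpos : ∀ g ∈ Q, n g = 0 → 0 < c g) :
    ∃ P : Subsemigroup G, IsLeftOrderCone P ∧ Q ≤ P := by
  by_cases h1 : ∀ g ∈ Q, 0 ≤ n g
  · obtain ⟨P, hP, hm⟩ := aux_lex n c hlam hn hc hinj 1 (by simp)
    refine ⟨P, hP, fun g hg => (hm g).2 ?_⟩
    rcases (h1 g hg).lt_or_eq with h | h
    · left; simpa using h
    · right; exact ⟨h.symm, hpos g hg h.symm⟩
  by_cases h2 : ∀ g ∈ Q, n g ≤ 0
  · obtain ⟨P, hP, hm⟩ := aux_lex n c hlam hn hc hinj (-1) (by simp)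
    refine ⟨P, hP, fun g hg => (hm g).2 ?_⟩
    rcases (h2 g hg).lt_or_eq with h | h
    · left; simpa using h
    · right; exact ⟨h, hpos g hg h⟩
  push Not at h1 h2
  obtain ⟨f0, hf0, nf0⟩ := h1
  obtain ⟨g0, hg0, ng0⟩ := h2
  have hl0 : (0 : ℚ) < lam := by linarith
  have hP : ∀ g, 0 < n g → 1 < lam ^ n g := fun g h => one_lt_zpow₀ hlam h
  have hN : ∀ g, n g < 0 → lam ^ n g < 1 := fun g h => zpow_lt_one_of_neg₀ hlam h
  let fix : G → ℚ := fun g => c g / (1 - lam ^ n g)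
  have hfix : ∀ g, n g ≠ 0 → c g = (1 - lam ^ n g) * fix g := by
    intro g h
    have : (1 - lam ^ n g) ≠ 0 := by
      rcases lt_or_gt_of_ne h with h | h
      · have := hN g h; intro h; linarith
      · have := hP g h; intro h; linarith
    simp only [fix]; field_simp
  have key : ∀ g ∈ Q, 0 < n g → ∀ f ∈ Q, n f < 0 → fix g < fix f := fun g hg ng f hf nf =>
    aux_key2 n c hlam hn hc Q hpos g f hg hf ng nf _ _ (hfix g (by omega)) (hfix f (by omega))
  let S : Set ℝ := {r | ∃ g ∈ Q, 0 < n g ∧ r = fix g}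
  have hS : S.Nonempty := ⟨_, g0, hg0, ng0, rfl⟩
  have hSub : ∀ f ∈ Q, n f < 0 → ∀ r ∈ S, r ≤ fix f := by
    rintro f hf nf r ⟨g, hg, ng, rfl⟩
    exact_mod_cast (key g hg ng f hf nf).le
  have hSb : BddAbove S := ⟨_, fun r hr => hSub f0 hf0 nf0 r hr⟩
  obtain ⟨x, hx⟩ : ∃ x, x = sSup S := ⟨_, rfl⟩
  have hxg : ∀ g ∈ Q, 0 < n g → (fix g : ℝ) ≤ x := fun g hg ng => by
    rw [hx]; exact le_csSup hSb ⟨g, hg, ng, rfl⟩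
  have hxf : ∀ f ∈ Q, n f < 0 → x ≤ (fix f : ℝ) := fun f hf nf => by
    rw [hx]; exact csSup_le hS (hSub f hf nf)
  obtain ⟨e, he, heg, hef⟩ : ∃ e : ℤ, e ≠ 0 ∧ (∀ g ∈ Q, 0 < n g → (fix g : ℝ) = x → 0 < e) ∧
      (∀ g ∈ Q, n g < 0 → (fix g : ℝ) = x → e < 0) := by
    by_cases h : ∃ g ∈ Q, 0 < n g ∧ (fix g : ℝ) = x
    · obtain ⟨g, hg, ng, hgx⟩ := h
      refine ⟨1, by simp, fun _ _ _ _ => by simp, fun f hf nf hfx => ?_⟩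
      have := key g hg ng f hf nf
      rw [← hgx] at hfx
      have : fix f = fix g := by exact_mod_cast hfx
      linarith
    · refine ⟨-1, by simp, fun g hg ng hgx => (h ⟨g, hg, ng, hgx⟩).elim, fun _ _ _ _ => by simp⟩
  obtain ⟨P, hPc, hm⟩ := aux_aff n c hlam hn hc hinj e he x
  refine ⟨P, hPc, fun g hg => (hm g).2 ?_⟩
  rcases lt_trichotomy (n g) 0 with h | h | h
  · have h1 : (lam : ℝ) ^ n g < 1 := by exact_mod_cast hN g h
    have h2 : (c g : ℝ) = (1 - (lam : ℝ) ^ n g) * fix g := by exact_mod_cast hfix g h.ne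
    rw [h2]
    rcases (hxf g hg h).lt_or_eq with k | k
    · left; nlinarith
    · right; refine ⟨by rw [← k]; ring, mul_pos_of_neg_of_neg (hef g hg h k.symm) h⟩
  · left
    have : (0 : ℝ) < c g := by exact_mod_cast hpos g hg h
    rw [h]; simpa using this
  · have h1 : 1 < (lam : ℝ) ^ n g := by exact_mod_cast hP g h
    have h2 : (c g : ℝ) = (1 - (lam : ℝ) ^ n g) * fix g := by exact_mod_cast hfix g h.ne'
    rw [h2]
    rcases (hxg g hg h).lt_or_eq with k | k
    · left; nlinarith
    · right; refine ⟨by rw [k]; ring, mul_pos (heg g hg h k) h⟩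

theorem aux_main (hlam : 1 < lam) (hn : ∀ g h, n (g * h) = n g + n h)
    (hc : ∀ g h, c (g * h) = lam ^ n g * c h + c g)
    (hinj : ∀ g, n g = 0 → c g = 0 → g = 1) : FullyLeftOrderable G := by
  intro Q hQ
  by_cases h : ∀ g ∈ Q, n g = 0 → 0 < c g
  · exact aux_main_pos n c hlam hn hc hinj Q h
  push Not at h
  obtain ⟨h, hh, nh, ch⟩ := h
  have ch' : c h < 0 := lt_of_le_of_ne ch fun h0 => hQ (hinj h nh h0 ▸ hh)
  apply aux_flip_cone
  obtain ⟨Q', hQ'⟩ := aux_flip Q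
  obtain ⟨P, hP, hle⟩ := aux_main_pos n c hlam hn hc hinj Q' (by
    intro g hg ng
    rw [hQ'] at hg
    have e := aux_cinv n c hlam hn hc g
    have ng' : n g⁻¹ = 0 := by rw [aux_ninv n hn, ng]; rfl
    rw [ng] at e
    simp at e
    by_contra hcon
    rcases lt_or_eq_of_le (not_lt.1 hcon) with k | k
    · exact aux_key1 n c hn hc hinj Q hQ g⁻¹ h hg hh ng' nh (by linarith) ch'
    · have := hinj g ng k
      subst this
      simp at hg
      exact hQ hg)
  exact ⟨P, hP, fun g hg => hle ((hQ' _).2 (by simpa using hg))⟩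

end

theorem stmt17 (lam : ℚ) (hlam : 1 < lam) :
    FullyLeftOrderable ↥(GLam lam hlam) := by
  have hl0 : (0 : ℚ) < lam := by linarith
  have H : ∀ g : GLam lam hlam, ∃ n : ℤ, ∃ c : ℚ, ∀ x : ℚ, g.1 x = lam ^ n * x + c := by
    rintro ⟨g, n, c, _, h⟩
    exact ⟨n, c, h⟩
  choose n c hg using H
  have hcomp : ∀ g h : GLam lam hlam, ∀ x, lam ^ n (g * h) * x + c (g * h) =
      lam ^ n g * (lam ^ n h * x + c h) + c g := by
    intro g h x
    rw [← hg, ← hg, ← hg]; rfl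
  have hcc : ∀ g h, c (g * h) = lam ^ n g * c h + c g := by
    intro g h
    simpa using hcomp g h 0
  refine aux_main n c hlam ?_ hcc ?_
  · intro g h
    have h1 := hcomp g h 1
    rw [hcc] at h1
    apply zpow_right_injective₀ hl0 hlam.ne'
    simp only
    rw [zpow_add₀ hl0.ne']
    linarith
  · intro g h0 h1
    apply Subtype.ext
    apply Equiv.ext
    intro x
    rw [hg, h0, h1]; simp
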